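/- Let n and k be integers with k ≥ 1 and n > k+1, and let x ∈ (-1, 1) be any real zero of T_n^{(k+1)}. Then (T_n^{(k)}(x))² · (1-x²)^k · S_{n,k+1}(x) = ((2k-1)!!/(2k)!!) · (n/(n-k)) · (binom(n+k, n-k))⁻¹ · (T_n^{(k)}(1))². -/

import Mathlib

open Polynomial Finset

/-- The odd double factorial `(2k-1)!! = 1·3·5⋯(2k-1)`. -/
noncomputable def oddDoubleFac (k : ℕ) : ℝ := ∏ j ∈ Finset.range k, (2 * (j : ℝ) + 1)

/-- The even double factorial `(2k)!! = 2·4⋯(2k)`. -/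
noncomputable def evenDoubleFac (k : ℕ) : ℝ := ∏ j ∈ Finset.range k, (2 * (j : ℝ) + 2)

/-- `S_{n,k}(x) = 1 + Σ_{m=1}^{k-1} ((2m-1)!!/(2m)!!) (k-m)_{2m} (1-x²)^{-m} ∏_{j=1}^m (n²-j²)⁻¹`. -/
noncomputable def S (n k : ℕ) (x : ℝ) : ℝ :=
  1 + ∑ m ∈ Finset.Icc 1 (k - 1),
    (oddDoubleFac m / evenDoubleFac m) *
      ((ascPochhammer ℝ (2 * m)).eval ((k : ℝ) - (m : ℝ))) *
      ((1 - x ^ 2) ^ m)⁻¹ *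
      ∏ j ∈ Finset.Icc 1 m, ((n : ℝ) ^ 2 - (j : ℝ) ^ 2)⁻¹

/-- The coefficient of `(1 - x²)^{-m}` in `S n (k + 1) x`. -/
noncomputable def sCoeff (n k m : ℕ) : ℝ :=
  (oddDoubleFac m / evenDoubleFac m) *
    ((ascPochhammer ℝ (2 * m)).eval ((k : ℝ) + 1 - m)) *
    ∏ j ∈ Finset.Icc 1 m, ((n : ℝ) ^ 2 - (j : ℝ) ^ 2)⁻¹

/-- The polynomial `Y ^ k * S n (k + 1)` in the variable `Y = 1 - x²`. -/
noncomputable def sPoly (n k : ℕ) : ℝ[X] :=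
  ∑ j ∈ Finset.range (k + 1), monomial j (sCoeff n k (k - j))

lemma sCoeff_zero (n k : ℕ) : sCoeff n k 0 = 1 := by
  simp [sCoeff, oddDoubleFac, evenDoubleFac]

lemma evenDoubleFac_pos (k : ℕ) : 0 < evenDoubleFac k :=
  Finset.prod_pos fun _ _ => by positivity

lemma sq_sub_sq_pos {m n : ℕ} (h : m < n) : (0 : ℝ) < (n : ℝ) ^ 2 - (m : ℝ) ^ 2 := by
  have h' : (m : ℝ) < n := by exact_mod_cast h
  nlinarith [Nat.cast_nonneg (α := ℝ) m]

lemma sCoeff_succ (n k m : ℕ) (hm : m + 1 < n) :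
    2 * ((m : ℝ) + 1) * ((n : ℝ) ^ 2 - ((m : ℝ) + 1) ^ 2) * sCoeff n k (m + 1) =
      ((k : ℝ) - m) * (2 * m + 1) * (k + m + 1) * sCoeff n k m := by
  have hE := (evenDoubleFac_pos m).ne'
  have hpos := (sq_sub_sq_pos hm).ne'
  have hm1 : (2 * (m : ℝ) + 2) ≠ 0 := by positivity
  push_cast at hpos
  have hodd : oddDoubleFac (m + 1) = oddDoubleFac m * (2 * m + 1) := by
    simp [oddDoubleFac, Finset.prod_range_succ]
  have heven : evenDoubleFac (m + 1) = evenDoubleFac m * (2 * m + 2) := by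
    simp [evenDoubleFac, Finset.prod_range_succ]
  have hasc : (ascPochhammer ℝ (2 * (m + 1))).eval ((k : ℝ) + 1 - ((m + 1 : ℕ) : ℝ)) =
      ((k : ℝ) - m) * (k + m + 1) * (ascPochhammer ℝ (2 * m)).eval ((k : ℝ) + 1 - m) := by
    rw [show 2 * (m + 1) = 2 * m + 1 + 1 by ring, ascPochhammer_succ_eval, ascPochhammer_succ_left]
    simp only [eval_mul, eval_X, eval_comp, eval_add, eval_one]
    push_cast
    rw [show (k : ℝ) + 1 - (m + 1) + 1 = k + 1 - m by ring]
    ring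
  unfold sCoeff
  rw [hodd, heven, hasc, Finset.prod_Icc_succ_top (by omega)]
  push_cast
  generalize ∏ j ∈ Finset.Icc 1 m, ((n : ℝ) ^ 2 - (j : ℝ) ^ 2)⁻¹ = P
  field_simp

lemma prod_sq_sub_sq (n k : ℕ) (hk : k ≤ n) :
    (∏ j ∈ Finset.Icc 1 k, ((n : ℝ) ^ 2 - (j : ℝ) ^ 2)) * n * ((n - k).factorial : ℝ) =
      ((n + k).factorial : ℝ) * ((n : ℝ) - k) := by
  induction k with
  | zero => simp [mul_comm]
  | succ k ih =>
    have ih := ih (by omega)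
    obtain ⟨d, rfl⟩ := Nat.exists_eq_add_of_le hk
    rw [show k + 1 + d - k = d + 1 by omega, Nat.factorial_succ] at ih
    rw [show k + 1 + d - (k + 1) = d by omega, Finset.prod_Icc_succ_top (by omega),
      ← add_assoc (k + 1 + d) k 1, Nat.factorial_succ]
    push_cast at ih ⊢
    have hd : (d : ℝ) + 1 ≠ 0 := by positivity
    apply mul_left_cancel₀ hd
    linear_combination ((k + 1 + d : ℝ) ^ 2 - (k + 1) ^ 2) * ih

lemma sCoeff_self (n k : ℕ) (hk : k < n) :
    sCoeff n k k = (oddDoubleFac k / evenDoubleFac k) * ((n : ℝ) / ((n : ℝ) - (k : ℝ))) *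
        ((Nat.choose (n + k) (n - k) : ℝ))⁻¹ := by
  have hprod := prod_sq_sub_sq n k hk.le
  have hchoose := Nat.choose_mul_factorial_mul_factorial (show n - k ≤ n + k by omega)
  rw [show n + k - (n - k) = 2 * k by omega] at hchoose
  have hC : ((n + k).choose (n - k) : ℝ) ≠ 0 := by
    exact_mod_cast (Nat.choose_pos (by omega)).ne'
  have hP : ∏ j ∈ Finset.Icc 1 k, ((n : ℝ) ^ 2 - (j : ℝ) ^ 2) ≠ 0 :=
    Finset.prod_ne_zero_iff.mpr fun j hj =>
      (sq_sub_sq_pos ((Finset.mem_Icc.mp hj).2.trans_lt hk)).ne'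
  have hnk : (n : ℝ) - k ≠ 0 := sub_ne_zero.mpr (by exact_mod_cast hk.ne')
  have hF : ((n - k).factorial : ℝ) ≠ 0 := by exact_mod_cast Nat.factorial_ne_zero _
  have hchoose' : ((n + k).choose (n - k) : ℝ) * ((n - k).factorial : ℝ) *
      ((2 * k).factorial : ℝ) = ((n + k).factorial : ℝ) := by exact_mod_cast hchoose
  have key : ((2 * k).factorial : ℝ) * (∏ j ∈ Finset.Icc 1 k, ((n : ℝ) ^ 2 - (j : ℝ) ^ 2))⁻¹ =
      ((n : ℝ) / ((n : ℝ) - (k : ℝ))) * ((Nat.choose (n + k) (n - k) : ℝ))⁻¹ := by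
    field_simp
    apply mul_left_cancel₀ hF
    linear_combination ((n : ℝ) - k) * hchoose' - hprod
  unfold sCoeff
  rw [add_sub_cancel_left, ascPochhammer_eval_one, Finset.prod_inv_distrib, mul_assoc, key]
  ring

lemma coeff_sPoly (n k j : ℕ) :
    (sPoly n k).coeff j = if j ≤ k then sCoeff n k (k - j) else 0 := by
  simp [sPoly, coeff_monomial]

lemma coeff_sPoly_succ (n k j : ℕ) (hn : k < n) :
    ((j : ℝ) + 1) * (2 * j - 2 * k + 1) * (j - 2 * k) * (sPoly n k).coeff (j + 1) +
      2 * ((j : ℝ) - k) * ((n : ℝ) ^ 2 - (k - j) ^ 2) * (sPoly n k).coeff j = 0 := by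
  rw [coeff_sPoly, coeff_sPoly]
  rcases lt_trichotomy j k with h | rfl | h
  · rw [if_pos (show j + 1 ≤ k from h), if_pos h.le]
    obtain ⟨m, rfl⟩ := Nat.exists_eq_add_of_lt h
    have := sCoeff_succ n (j + m + 1) m (by omega)
    rw [show j + m + 1 - (j + 1) = m by omega, show j + m + 1 - j = m + 1 by omega]
    push_cast at this ⊢
    linear_combination -this
  · simp
  · rw [if_neg (by omega), if_neg (by omega)]
    ring

/-- The differential equation satisfied by `sPoly n k`. -/
lemma sPoly_ode (n k : ℕ) (hn : k < n) :
    C 2 * (X ^ 2 * derivative (derivative (derivative (sPoly n k))))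
      - C 2 * (X ^ 3 * derivative (derivative (derivative (sPoly n k))))
      + C (3 - 6 * (k : ℝ)) * (X * derivative (derivative (sPoly n k)))
      + C (6 * (k : ℝ) - 6) * (X ^ 2 * derivative (derivative (sPoly n k)))
      + C ((2 * (k : ℝ) + 1) ^ 2 - (6 * k + 1)) * derivative (sPoly n k)
      + C (12 * (k : ℝ) + 2 * ((n : ℝ) ^ 2 - (k + 1) ^ 2) - (2 * k + 1) * (2 * k)) *
        (X * derivative (sPoly n k))
      - C (2 * (k : ℝ) * ((n : ℝ) ^ 2 - (k + 1) ^ 2) + (2 * k + 1) * (2 * k)) * sPoly n k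
      = 0 := by
  ext j
  have h := coeff_sPoly_succ n k j hn
  have h₂ (j : ℕ) : j + 1 + 1 + 1 - 2 = j + 1 := rfl
  have h₃ (j : ℕ) : j + 1 + 1 + 1 - 3 = j := rfl
  rcases j with _ | _ | _ | j <;>
    simp only [coeff_add, coeff_sub, coeff_C_mul, coeff_X_pow_mul', coeff_X_mul,
      coeff_X_mul_zero, coeff_derivative, coeff_zero, h₂, h₃] at h ⊢ <;>
    norm_num at h ⊢ <;>
    linear_combination h

lemma eval_sPoly (n k : ℕ) {x : ℝ} (hx : 1 - x ^ 2 ≠ 0) :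
    (sPoly n k).eval (1 - x ^ 2) = (1 - x ^ 2) ^ k * S n (k + 1) x := by
  have hS : S n (k + 1) x =
      ∑ m ∈ Finset.range (k + 1), sCoeff n k m * ((1 - x ^ 2) ^ m)⁻¹ := by
    rw [Finset.range_eq_Ico, Finset.sum_eq_sum_Ico_succ_bot (by omega), sCoeff_zero, S,
      add_tsub_cancel_right]
    congr 1
    · simp
    · refine Finset.sum_congr (by ext; simp) fun m _ => ?_
      rw [sCoeff]
      push_cast
      ring
  rw [hS, sPoly, eval_finsetSum, ← Finset.sum_range_reflect, Finset.mul_sum]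
  refine Finset.sum_congr rfl fun m hm => ?_
  have hm : m ≤ k := by simpa [Nat.lt_succ_iff] using hm
  obtain ⟨d, rfl⟩ := Nat.exists_eq_add_of_le hm
  rw [show m + d + 1 - 1 - m = d by omega, show m + d - d = m by omega, eval_monomial, pow_add]
  field_simp

/-- The quadratic first integral attached to `derivative^[k + 1] (Chebyshev.T ℝ n)`. -/
noncomputable def chebyshevInvariant (n k : ℕ) : ℝ[X] :=
  let a := derivative^[k + 1] (Chebyshev.T ℝ (n : ℤ))
  let D : ℝ[X] := 1 - X ^ 2
  let F := (sPoly n k).comp D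
  let F₁ := (derivative (sPoly n k)).comp D
  let F₂ := (derivative (derivative (sPoly n k))).comp D
  D ^ 2 * F * derivative a ^ 2 -
    (-2 * X * D ^ 2 * F₁ + 2 * (2 * (k : ℝ[X]) + 1) * X * D * F) * a * derivative a +
    (2 * D ^ 2 * (1 - D) * F₂ + (6 * (k : ℝ[X]) * D ^ 2 - (6 * (k : ℝ[X]) + 1) * D) * F₁ +
      ((2 * (k : ℝ[X]) + 1) ^ 2 +
        ((n : ℝ[X]) ^ 2 - ((k : ℝ[X]) + 1) ^ 2 -
          (2 * (k : ℝ[X]) + 1) * (2 * (k : ℝ[X]))) * D) * F) * a ^ 2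

lemma derivative_chebyshevInvariant (n k : ℕ) (hn : k < n) :
    derivative (chebyshevInvariant n k) = 0 := by
  have hT := Chebyshev.one_sub_X_sq_mul_iterate_derivative_T_eq_poly_in_T (R := ℝ) (n : ℤ) (k + 1)
  have hF := congrArg (fun p => p.comp (1 - X ^ 2 : ℝ[X])) (sPoly_ode n k hn)
  simp only [add_comp, sub_comp, mul_comp, C_comp, X_comp, pow_comp, zero_comp] at hF
  simp only [Function.iterate_succ_apply'] at hT
  simp only [chebyshevInvariant, derivative_add, derivative_sub, derivative_mul, derivative_pow,
    derivative_comp, derivative_X, derivative_one, derivative_neg, derivative_natCast,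
    derivative_ofNat, Function.iterate_succ_apply']
  set a₀ := derivative (derivative^[k] (Chebyshev.T ℝ (n : ℤ)))
  set a₁ := derivative a₀
  set a₂ := derivative a₁
  generalize (sPoly n k).comp (1 - X ^ 2) = F₀ at *
  generalize (derivative (sPoly n k)).comp (1 - X ^ 2) = F₁ at *
  generalize (derivative (derivative (sPoly n k))).comp (1 - X ^ 2) = F₂ at *
  generalize (derivative (derivative (derivative (sPoly n k)))).comp (1 - X ^ 2) = F₃ at *
  simp only [map_add, map_sub, map_mul, map_pow, map_natCast, map_ofNat, map_one] at hF ⊢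
  push_cast at hT ⊢
  linear_combination ((1 - X ^ 2) * (2 * F₀ * a₁) -
    (-2 * X * (1 - X ^ 2) * F₁ + 2 * (2 * (k : ℝ[X]) + 1) * X * F₀) * a₀) * hT -
    2 * X * a₀ ^ 2 * hF

theorem stmt13 (n k : ℕ) (hk : 1 ≤ k) (hn : k + 1 < n) (x : ℝ)
    (hx : x ∈ Set.Ioo (-1 : ℝ) 1)
    (hxroot : (derivative^[k + 1] (Chebyshev.T ℝ (n : ℤ))).eval x = 0) :
    ((derivative^[k] (Chebyshev.T ℝ (n : ℤ))).eval x) ^ 2 * (1 - x ^ 2) ^ k *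
        S n (k + 1) x =
      (oddDoubleFac k / evenDoubleFac k) * ((n : ℝ) / ((n : ℝ) - (k : ℝ))) *
        ((Nat.choose (n + k) (n - k) : ℝ))⁻¹ *
        ((derivative^[k] (Chebyshev.T ℝ (n : ℤ))).eval 1) ^ 2 := by
  have hkn : k < n := by omega
  have hD : 1 - x ^ 2 ≠ 0 := by nlinarith [hx.1, hx.2]
  have hconst : (chebyshevInvariant n k).eval x = (chebyshevInvariant n k).eval 1 := by
    rw [eq_C_of_derivative_eq_zero (derivative_chebyshevInvariant n k hkn), eval_C, eval_C]
  have hTx := Chebyshev.one_sub_X_sq_mul_iterate_derivative_T_eval (R := ℝ) (n : ℤ) k x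
  have hT1 := Chebyshev.one_sub_X_sq_mul_iterate_derivative_T_eval (R := ℝ) (n : ℤ) k 1
  have hF1 : (sPoly n k).eval 0 = sCoeff n k k := by
    rw [← coeff_zero_eq_eval_zero, coeff_sPoly]
    simp
  have hFx := eval_sPoly n k hD
  have hpos := (sq_sub_sq_pos hkn).ne'
  rw [← sCoeff_self n k hkn]
  simp only [chebyshevInvariant, eval_add, eval_sub, eval_mul, eval_pow, eval_comp, eval_X,
    eval_one, eval_neg, eval_natCast, eval_ofNat, hxroot, one_pow, sub_self, hF1, hFx] at hconst
  rw [hxroot, Function.iterate_succ_apply'] at hTx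
  push_cast at hTx hT1
  apply mul_left_cancel₀ (pow_ne_zero 2 hpos)
  set a := (derivative^[k + 1] (Chebyshev.T ℝ (n : ℤ))).eval 1
  set b := (derivative (derivative^[k + 1] (Chebyshev.T ℝ (n : ℤ)))).eval x
  set u := (derivative^[k] (Chebyshev.T ℝ (n : ℤ))).eval x
  set v := (derivative^[k] (Chebyshev.T ℝ (n : ℤ))).eval 1
  linear_combination hconst +
    (1 - x ^ 2) ^ k * S n (k + 1) x * (((n : ℝ) ^ 2 - k ^ 2) * u - (1 - x ^ 2) * b) * hTx -
    sCoeff n k k * ((2 * k + 1) * a + ((n : ℝ) ^ 2 - k ^ 2) * v) * hT1
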